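/- arXiv:2110.04150 — 5 statements merged into one kernel-verified Lean document; each statement's English description precedes it below -/
import Mathlib

section
/- Under these hypotheses, the contraction constant C_C := 1/2 + √(1/4 − C_A·C_N) lies in [1/2, 1), and for every ψ ∈ H: (1 − C_C)·‖ψ‖_{A⁻¹} ≤ ‖((1/2)·I − C)ψ‖_{A⁻¹} ≤ C_C·‖ψ‖_{A⁻¹}. -/
open scoped RealInnerProductSpace

section CoerciveInverse

variable {H : Type*} [NormedAddCommGroup H] [InnerProductSpace ℝ H]

theorem sq_inner_map_le_of_symmetric_of_nonneg (T : H →L[ℝ] H)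
    (hsym : ∀ x y : H, ⟪T x, y⟫ = ⟪x, T y⟫) (hpos : ∀ x : H, 0 ≤ ⟪T x, x⟫) (x y : H) :
    ⟪T x, y⟫ ^ 2 ≤ ⟪T x, x⟫ * ⟪T y, y⟫ := by
  have hquad : ∀ t : ℝ, 0 ≤ ⟪T y, y⟫ * (t * t) + (2 * ⟪T x, y⟫) * t + ⟪T x, x⟫ := by
    intro t
    have hyx : ⟪T y, x⟫ = ⟪T x, y⟫ := by rw [hsym y x, real_inner_comm]
    have h := hpos (x + t • y)
    simp only [map_add, map_smul, inner_add_left, inner_add_right, real_inner_smul_left,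
      real_inner_smul_right, hyx] at h
    linarith
  have hdisc := discrim_le_zero hquad
  rw [discrim] at hdisc
  linarith

theorem mul_inner_le_sq_norm_of_coercive {A : H →L[ℝ] H} {c : ℝ} (hc : 0 < c)
    (hcoer : ∀ x : H, c * ‖x‖ ^ 2 ≤ ⟪A x, x⟫) (x : H) :
    c * ⟪A x, x⟫ ≤ ‖A x‖ ^ 2 := by
  have h := hcoer x
  have hcs := real_inner_le_norm (A x) x
  have hle : c * ‖x‖ ≤ ‖A x‖ := by
    rcases (norm_nonneg x).eq_or_lt with hx | hx
    · rw [← hx, mul_zero]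
      exact norm_nonneg _
    · exact le_of_mul_le_mul_right (by linarith) hx
  calc c * ⟪A x, x⟫ ≤ c * (‖A x‖ * ‖x‖) := by gcongr
    _ = ‖A x‖ * (c * ‖x‖) := by ring
    _ ≤ ‖A x‖ * ‖A x‖ := by gcongr
    _ = ‖A x‖ ^ 2 := by ring

end CoerciveInverse

theorem abs_sub_half_le_sqrt_mul {a b c : ℝ} (hb : 0 ≤ b) (hc : c ≤ 1 / 4)
    (h : a ^ 2 + c * b ^ 2 ≤ a * b) : |a - b / 2| ≤ √(1 / 4 - c) * b := by
  refine abs_le_of_sq_le_sq ?_ (by positivity)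
  rw [mul_pow, Real.sq_sqrt (by linarith)]
  linarith

/-- abstract form of Lemma 4.1, first assertion. Let `H` be a real Hilbert
space, `A, B, C, N : H →L[ℝ] H` bounded linear operators, `C_A, C_N > 0` with
`C_A·C_N ≤ 1/4`, `A` self-adjoint and coercive with constant `C_A` (with bounded inverse
`A'`), `N` coercive with constant `C_N`, `B` and `C` skew-adjoint to each other, and assume
the symmetric representation `A'∘((1/2)·I − C) = ((1/2)·I + B)∘A'∘((1/2)·I − C) + N` of the
Steklov–Poincaré operator. Then `C_C := 1/2 + √(1/4 − C_A·C_N) ∈ [1/2, 1)` and for every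
`ψ ∈ H`,
`(1 − C_C)·‖ψ‖_{A⁻¹} ≤ ‖((1/2)·I − C)ψ‖_{A⁻¹} ≤ C_C·‖ψ‖_{A⁻¹}`,
where `‖v‖_{A⁻¹} = ⟪A'v, v⟫^{1/2}`. -/
theorem contraction_estimate
    {H : Type*} [NormedAddCommGroup H] [InnerProductSpace ℝ H] [CompleteSpace H]
    (A B C N A' : H →L[ℝ] H) (CA CN : ℝ) (hCA : 0 < CA) (hCN : 0 < CN)
    (hCACN : CA * CN ≤ 1 / 4)
    (hAsym : ∀ x y : H, ⟪A x, y⟫ = ⟪x, A y⟫)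
    (hAcoer : ∀ ψ : H, CA * ‖ψ‖ ^ 2 ≤ ⟪A ψ, ψ⟫)
    (hNcoer : ∀ ψ : H, CN * ‖ψ‖ ^ 2 ≤ ⟪N ψ, ψ⟫)
    (hBC : ∀ φ ξ : H, ⟪B φ, ξ⟫ = -⟪φ, C ξ⟫)
    (hA'l : A.comp A' = ContinuousLinearMap.id ℝ H)
    (hA'r : A'.comp A = ContinuousLinearMap.id ℝ H)
    (hSym : A'.comp ((1 / 2 : ℝ) • ContinuousLinearMap.id ℝ H - C)
        = (((1 / 2 : ℝ) • ContinuousLinearMap.id ℝ H + B).comp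
            (A'.comp ((1 / 2 : ℝ) • ContinuousLinearMap.id ℝ H - C))) + N) :
    (1 / 2 + Real.sqrt (1 / 4 - CA * CN)) ∈ Set.Ico (1 / 2 : ℝ) 1 ∧
    ∀ ψ : H,
      (1 - (1 / 2 + Real.sqrt (1 / 4 - CA * CN))) * Real.sqrt ⟪A' ψ, ψ⟫
          ≤ Real.sqrt ⟪A' ((1 / 2 : ℝ) • ψ - C ψ), (1 / 2 : ℝ) • ψ - C ψ⟫ ∧
      Real.sqrt ⟪A' ((1 / 2 : ℝ) • ψ - C ψ), (1 / 2 : ℝ) • ψ - C ψ⟫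
          ≤ (1 / 2 + Real.sqrt (1 / 4 - CA * CN)) * Real.sqrt ⟪A' ψ, ψ⟫ := by
  have hAA' : ∀ x, A (A' x) = x := fun x => DFunLike.congr_fun hA'l x
  have hsym : ∀ x y : H, ⟪A' x, y⟫ = ⟪x, A' y⟫ := fun x y => by
    simpa only [hAA'] using (hAsym (A' x) (A' y)).symm
  have hinner : ∀ x : H, ⟪A (A' x), A' x⟫ = ⟪A' x, x⟫ := fun x => by
    rw [hAA', real_inner_comm]
  have hpos : ∀ x : H, 0 ≤ ⟪A' x, x⟫ := fun x => by
    have := hAcoer (A' x)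
    rw [hinner] at this
    exact le_trans (by positivity) this
  refine ⟨⟨by linarith [Real.sqrt_nonneg (1 / 4 - CA * CN)], ?_⟩, fun ψ => ?_⟩
  · have : √(1 / 4 - CA * CN) < 1 / 2 := by
      rw [Real.sqrt_lt' (by norm_num)]
      linarith [mul_pos hCA hCN]
    linarith
  set y : H := (1 / 2 : ℝ) • ψ - C ψ
  have hrep : A' y = (1 / 2 : ℝ) • A' y + B (A' y) + N ψ :=
    DFunLike.congr_fun hSym ψ
  have hSψ : ⟪A' y, ψ⟫ = ⟪A' y, y⟫ + ⟪N ψ, ψ⟫ := by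
    have hadj : ⟪A' y, y⟫ = (1 / 2 : ℝ) * ⟪A' y, ψ⟫ + ⟪B (A' y), ψ⟫ := by
      rw [hBC, ← sub_eq_add_neg, ← real_inner_smul_right, ← inner_sub_right]
    have h := congrArg (fun v => ⟪v, ψ⟫) hrep
    simp only [inner_add_left, real_inner_smul_left] at h
    linarith
  have hN : CA * CN * ⟪A' ψ, ψ⟫ ≤ ⟪N ψ, ψ⟫ := by
    have h := mul_inner_le_sq_norm_of_coercive hCA hAcoer (A' ψ)
    rw [hinner, hAA'] at h
    calc CA * CN * ⟪A' ψ, ψ⟫ = CN * (CA * ⟪A' ψ, ψ⟫) := by ring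
      _ ≤ CN * ‖ψ‖ ^ 2 := by gcongr
      _ ≤ ⟪N ψ, ψ⟫ := hNcoer ψ
  have hcs : ⟪A' y, ψ⟫ ≤ √⟪A' y, y⟫ * √⟪A' ψ, ψ⟫ := by
    rw [← Real.sqrt_mul (hpos y)]
    exact Real.le_sqrt_of_sq_le (sq_inner_map_le_of_symmetric_of_nonneg A' hsym hpos y ψ)
  have habs := abs_sub_half_le_sqrt_mul (a := √⟪A' y, y⟫) (Real.sqrt_nonneg ⟪A' ψ, ψ⟫) hCACN (by
    rw [Real.sq_sqrt (hpos y), Real.sq_sqrt (hpos ψ)]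
    linarith)
  obtain ⟨hlo, hhi⟩ := abs_le.mp habs
  constructor <;> linarith
end

section
/- Under these hypotheses, with contraction constant C_C := 1/2 + √(1/4 − C_A·C_N), for every ψ ∈ H: ‖((1/2)·I − C)ψ‖²_{A⁻¹} ≤ C_C·⟨Sψ, ψ⟩, where S := A⁻¹((1/2)·I − C). -/
open scoped RealInnerProductSpace

/-- The quadratic inequality `c s² ≤ a (s - a)` bounds `a` by the larger root. -/
theorem le_mul_of_mul_sq_le_mul_sub {a s c : ℝ} (hc : c ≤ 1 / 4) (hs : 0 ≤ s)
    (h : c * s ^ 2 ≤ a * (s - a)) : a ≤ (1 / 2 + Real.sqrt (1 / 4 - c)) * s := by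
  have hsq : (a - s / 2) ^ 2 ≤ (Real.sqrt (1 / 4 - c) * s) ^ 2 := by
    rw [mul_pow, Real.sq_sqrt (sub_nonneg.2 hc)]
    linarith
  have := abs_le_of_sq_le_sq' hsq (by positivity)
  linarith [this.2]

/-- abstract form of Lemma 4.1, second assertion. Under the hypotheses of
the contraction lemma, with contraction constant `C_C := 1/2 + √(1/4 − C_A·C_N)`, for every
`ψ ∈ H` one has `‖((1/2)·I − C)ψ‖²_{A⁻¹} ≤ C_C·⟪Sψ, ψ⟫` where `S := A⁻¹((1/2)·I − C)` and
`‖v‖²_{A⁻¹} = ⟪A⁻¹v, v⟫`. -/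
theorem contraction_estimate_steklov
    {H : Type*} [NormedAddCommGroup H] [InnerProductSpace ℝ H] [CompleteSpace H]
    (A B C N A' : H →L[ℝ] H) (CA CN : ℝ) (hCA : 0 < CA) (hCN : 0 < CN)
    (hCACN : CA * CN ≤ 1 / 4)
    (hAsym : ∀ x y : H, ⟪A x, y⟫ = ⟪x, A y⟫)
    (hAcoer : ∀ ψ : H, CA * ‖ψ‖ ^ 2 ≤ ⟪A ψ, ψ⟫)
    (hNcoer : ∀ ψ : H, CN * ‖ψ‖ ^ 2 ≤ ⟪N ψ, ψ⟫)
    (hBC : ∀ φ ξ : H, ⟪B φ, ξ⟫ = -⟪φ, C ξ⟫)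
    (hA'l : A.comp A' = ContinuousLinearMap.id ℝ H)
    (hA'r : A'.comp A = ContinuousLinearMap.id ℝ H)
    (hSym : A'.comp ((1 / 2 : ℝ) • ContinuousLinearMap.id ℝ H - C)
        = (((1 / 2 : ℝ) • ContinuousLinearMap.id ℝ H + B).comp
            (A'.comp ((1 / 2 : ℝ) • ContinuousLinearMap.id ℝ H - C))) + N) :
    ∀ ψ : H,
      ⟪A' ((1 / 2 : ℝ) • ψ - C ψ), (1 / 2 : ℝ) • ψ - C ψ⟫
        ≤ (1 / 2 + Real.sqrt (1 / 4 - CA * CN)) *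
            ⟪(A'.comp ((1 / 2 : ℝ) • ContinuousLinearMap.id ℝ H - C)) ψ, ψ⟫ := by
  intro ψ
  set w : H := (1 / 2 : ℝ) • ψ - C ψ with hw
  have hS : (A'.comp ((1 / 2 : ℝ) • ContinuousLinearMap.id ℝ H - C)) ψ = A' w := by
    simp [hw]
  have hAw : A (A' w) = w := by
    simpa using congrArg (fun T : H →L[ℝ] H => T w) hA'l
  have hsplit : ⟪A' w, ψ⟫ = ⟪A' w, w⟫ + ⟪N ψ, ψ⟫ := by
    have h : A' w = (1 / 2 : ℝ) • A' w + B (A' w) + N ψ := by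
      have h := congrArg (fun T : H →L[ℝ] H => T ψ) hSym
      simp only [add_apply] at h
      rw [ContinuousLinearMap.comp_apply (_ + B), hS] at h
      simpa using h
    calc ⟪A' w, ψ⟫ = ⟪(1 / 2 : ℝ) • A' w + B (A' w) + N ψ, ψ⟫ := by rw [← h]
      _ = ⟪A' w, w⟫ + ⟪N ψ, ψ⟫ := by
        rw [inner_add_left, inner_add_left, hBC, real_inner_smul_left, hw, inner_sub_right,
          real_inner_smul_right]
        ring
  have hu := hAcoer (A' w)
  rw [hAw, real_inner_comm] at hu
  have hn := hNcoer ψ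
  have hcs : ⟪A' w, ψ⟫ ^ 2 ≤ ‖A' w‖ ^ 2 * ‖ψ‖ ^ 2 := by
    rw [← mul_pow]
    exact sq_le_sq' (neg_le_of_abs_le (abs_real_inner_le_norm _ _)) (real_inner_le_norm _ _)
  rw [hS]
  have ha : 0 ≤ ⟪A' w, w⟫ := le_trans (by positivity) hu
  have hs : 0 ≤ ⟪A' w, ψ⟫ := by
    rw [hsplit]
    exact add_nonneg ha (le_trans (by positivity) hn)
  refine le_mul_of_mul_sq_le_mul_sub hCACN hs ?_
  calc CA * CN * ⟪A' w, ψ⟫ ^ 2 ≤ CA * CN * (‖A' w‖ ^ 2 * ‖ψ‖ ^ 2) := by gcongr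
    _ = (CA * ‖A' w‖ ^ 2) * (CN * ‖ψ‖ ^ 2) := by ring
    _ ≤ ⟪A' w, w⟫ * ⟪N ψ, ψ⟫ := by gcongr
    _ = ⟪A' w, w⟫ * (⟪A' w, ψ⟫ - ⟪A' w, w⟫) := by rw [hsplit]; ring
end

section
/- If C_M^𝒰 > C_C/4, then the coupling form is strongly monotone: there exists a constant C_E > 0 such that for all 𝐮, 𝐯 ∈ ℋ, setting 𝐰 := 𝐮 − 𝐯, one has b(𝐮, 𝐰) − b(𝐯, 𝐰) ≥ C_E·‖𝐰‖²_ℋ. -/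
open scoped RealInnerProductSpace

/-- The abstract Johnson–Nédélec FEM-BEM coupling form
`b((u, φ), (v, ψ)) = ⟪𝒰(c u), c v⟫ − ⟪φ, γ v⟫ + ⟪ψ, A φ⟫ + ⟪ψ, ((1/2)·I + C)(γ u)⟫`
on the product space `ℋ = V × T`. -/
noncomputable def couplingForm {V W T : Type*}
    [NormedAddCommGroup V] [InnerProductSpace ℝ V]
    [NormedAddCommGroup W] [InnerProductSpace ℝ W]
    [NormedAddCommGroup T] [InnerProductSpace ℝ T]
    (𝒰 : W → W) (c : V →L[ℝ] W) (γ : V →L[ℝ] T) (A C : T →L[ℝ] T)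
    (u : V) (φ : T) (v : V) (ψ : T) : ℝ :=
  ⟪𝒰 (c u), c v⟫ - ⟪φ, γ v⟫ + ⟪ψ, A φ⟫ + ⟪ψ, (1 / 2 : ℝ) • γ u + C (γ u)⟫

/-- Weighted Young inequality for a positive semidefinite symmetric form. -/
theorem inner_map_le_of_symmetric_of_nonneg {T : Type*}
    [NormedAddCommGroup T] [InnerProductSpace ℝ T] (A : T →L[ℝ] T)
    (hsym : ∀ x y : T, ⟪A x, y⟫ = ⟪x, A y⟫) (hnonneg : ∀ x : T, 0 ≤ ⟪A x, x⟫)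
    {t : ℝ} (ht : 0 < t) (x y : T) :
    ⟪A x, y⟫ ≤ t * ⟪A x, x⟫ + ⟪A y, y⟫ / (4 * t) := by
  have h := hnonneg (t • x - (1 / 2 : ℝ) • y)
  have hyx : ⟪A y, x⟫ = ⟪A x, y⟫ := by rw [hsym, real_inner_comm]
  simp only [map_sub, map_smul, inner_sub_left, inner_sub_right, real_inner_smul_left,
    real_inner_smul_right, hyx] at h
  have key : t * ⟪A x, x⟫ + ⟪A y, y⟫ / (4 * t) - ⟪A x, y⟫
      = (t * (t * ⟪A x, x⟫) - t * ⟪A x, y⟫ + ⟪A y, y⟫ / 4) / t := by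
    field_simp
    ring
  have hdiv : 0 ≤ (t * (t * ⟪A x, x⟫) - t * ⟪A x, y⟫ + ⟪A y, y⟫ / 4) / t :=
    div_nonneg (by linarith) ht.le
  linarith

/-- The increment of the coupling form, tested with the difference of its arguments. -/
theorem couplingForm_sub {V W T : Type*}
    [NormedAddCommGroup V] [InnerProductSpace ℝ V]
    [NormedAddCommGroup W] [InnerProductSpace ℝ W]
    [NormedAddCommGroup T] [InnerProductSpace ℝ T]
    (𝒰 : W → W) (c : V →L[ℝ] W) (γ : V →L[ℝ] T) (A C : T →L[ℝ] T) (u v : V) (φ ψ : T) :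
    couplingForm 𝒰 c γ A C u φ (u - v) (φ - ψ) - couplingForm 𝒰 c γ A C v ψ (u - v) (φ - ψ)
      = ⟪𝒰 (c u) - 𝒰 (c v), c u - c v⟫ + ⟪φ - ψ, A (φ - ψ)⟫
        - ⟪φ - ψ, (1 / 2 : ℝ) • γ (u - v) - C (γ (u - v))⟫ := by
  simp only [couplingForm, map_sub, inner_sub_left, inner_sub_right, inner_add_right,
    smul_sub, real_inner_smul_right]
  ring

/-- abstract form of Theorem 4.2, second assertion. Under the coercivity,
inverse, Friedrichs, splitting and contraction hypotheses, if `𝒰` is strongly monotone with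
constant `C_M^𝒰 > C_C/4`, then the coupling form is strongly monotone: there exists
`C_E > 0` with `b(𝐮, 𝐰) − b(𝐯, 𝐰) ≥ C_E·‖𝐰‖²_ℋ` for `𝐰 := 𝐮 − 𝐯`. -/
theorem couplingForm_strongly_monotone
    {V W T : Type*}
    [NormedAddCommGroup V] [InnerProductSpace ℝ V] [CompleteSpace V]
    [NormedAddCommGroup W] [InnerProductSpace ℝ W] [CompleteSpace W]
    [NormedAddCommGroup T] [InnerProductSpace ℝ T] [CompleteSpace T]
    (𝒰 : W → W) (c : V →L[ℝ] W) (γ : V →L[ℝ] T) (A C A' : T →L[ℝ] T)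
    (CA : ℝ) (hCA : 0 < CA)
    (hAsym : ∀ x y : T, ⟪A x, y⟫ = ⟪x, A y⟫)
    (hAcoer : ∀ ξ : T, CA * ‖ξ‖ ^ 2 ≤ ⟪A ξ, ξ⟫)
    (hA'l : A.comp A' = ContinuousLinearMap.id ℝ T)
    (hA'r : A'.comp A = ContinuousLinearMap.id ℝ T)
    (α : ℝ) (hα : 0 < α) (hFriedrichs : ∀ v : V, α * ‖v‖ ≤ ‖c v‖)
    (hsplit : ∀ w : V, ∃ wΓ wt : V, w = wΓ + wt ∧ γ wt = 0 ∧ ⟪c wΓ, c wt⟫ = 0 ∧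
      ‖c wΓ‖ ^ 2 = ⟪(A'.comp ((1 / 2 : ℝ) • ContinuousLinearMap.id ℝ T - C)) (γ w), γ w⟫)
    (CC : ℝ) (hCC : CC ∈ Set.Ico (1 / 2 : ℝ) 1)
    (hcontr : ∀ ξ : T, ⟪A' ((1 / 2 : ℝ) • ξ - C ξ), (1 / 2 : ℝ) • ξ - C ξ⟫
      ≤ CC * ⟪(A'.comp ((1 / 2 : ℝ) • ContinuousLinearMap.id ℝ T - C)) ξ, ξ⟫)
    (CMU : ℝ) (hCMU : 0 < CMU)
    (hmonoU : ∀ x y : W, CMU * ‖x - y‖ ^ 2 ≤ ⟪𝒰 x - 𝒰 y, x - y⟫)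
    (hcond : CC / 4 < CMU) :
    ∃ CE > 0, ∀ (u v : V) (φ ψ : T),
      CE * (‖u - v‖ ^ 2 + ‖φ - ψ‖ ^ 2)
        ≤ couplingForm 𝒰 c γ A C u φ (u - v) (φ - ψ)
            - couplingForm 𝒰 c γ A C v ψ (u - v) (φ - ψ) := by
  have hnonneg (ξ : T) : 0 ≤ ⟪A ξ, ξ⟫ := le_trans (by positivity) (hAcoer ξ)
  have hAA' (ξ : T) : A (A' ξ) = ξ := DFunLike.congr_fun hA'l ξ
  have hCC0 : 0 < CC := by linarith [hCC.1]
  -- the energy of the trace part is controlled by `c w`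
  have henergy (w : V) :
      ⟪A' ((1 / 2 : ℝ) • γ w - C (γ w)), (1 / 2 : ℝ) • γ w - C (γ w)⟫ ≤ CC * ‖c w‖ ^ 2 := by
    obtain ⟨wΓ, wt, hw, -, horth, hS⟩ := hsplit w
    refine (hcontr (γ w)).trans (mul_le_mul_of_nonneg_left ?_ hCC0.le)
    rw [← hS, hw, map_add, norm_add_sq_real, horth]
    nlinarith [sq_nonneg ‖c wt‖]
  obtain ⟨t, ht, ht1⟩ := exists_between ((div_lt_one hCMU).2 hcond)
  have ht0 : 0 < t := lt_trans (by positivity) ht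
  have hM : 0 < CMU - CC / (4 * t) := by
    rw [div_lt_iff₀ hCMU] at ht
    rw [sub_pos, div_lt_iff₀ (by positivity)]
    linarith
  refine ⟨min ((CMU - CC / (4 * t)) * α ^ 2) ((1 - t) * CA),
    lt_min (by positivity) (mul_pos (sub_pos.2 ht1) hCA), fun u v φ ψ => ?_⟩
  rw [couplingForm_sub]
  have hmono := hmonoU (c u) (c v)
  rw [← map_sub] at hmono ⊢
  generalize u - v = w at hmono ⊢
  generalize φ - ψ = ζ
  have hE := henergy w
  generalize (1 / 2 : ℝ) • γ w - C (γ w) = ρ at hE ⊢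
  have hyoung := inner_map_le_of_symmetric_of_nonneg A hAsym hnonneg ht0 ζ (A' ρ)
  rw [hAsym ζ (A' ρ), hAA', real_inner_comm (A' ρ) ρ] at hyoung
  have hEt : ⟪A' ρ, ρ⟫ / (4 * t) ≤ CC / (4 * t) * ‖c w‖ ^ 2 := by
    rw [div_mul_eq_mul_div]
    gcongr
  have hF : α ^ 2 * ‖w‖ ^ 2 ≤ ‖c w‖ ^ 2 := by
    rw [← mul_pow]
    exact pow_le_pow_left₀ (by positivity) (hFriedrichs w) 2
  have hζ := mul_le_mul_of_nonneg_left (hAcoer ζ) (sub_pos.2 ht1).le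
  have hw := mul_le_mul_of_nonneg_left hF hM.le
  have hmin₁ := mul_le_mul_of_nonneg_right
    (min_le_left ((CMU - CC / (4 * t)) * α ^ 2) ((1 - t) * CA)) (sq_nonneg ‖w‖)
  have hmin₂ := mul_le_mul_of_nonneg_right
    (min_le_right ((CMU - CC / (4 * t)) * α ^ 2) ((1 - t) * CA)) (sq_nonneg ‖ζ‖)
  rw [hAsym ζ ζ] at hyoung hζ
  linarith
end

section
/- Assume 𝒰 is Lipschitz continuous with constant C_L^𝒰 > 0 and strongly monotone with constant C_M^𝒰 > 0, and that C_M^𝒰 > C_C/4. Then for every bounded linear functional ℓ : ℋ → ℝ there exists a unique 𝐮 ∈ ℋ such that b(𝐮, 𝐯) = ℓ(𝐯) for all 𝐯 ∈ ℋ. -/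
open scoped RealInnerProductSpace

/-- Zarantonello's theorem: a Lipschitz continuous, strongly monotone map of a real Hilbert space
into itself is bijective. -/
theorem bijective_of_lipschitz_of_stronglyMonotone {V : Type*}
    [NormedAddCommGroup V] [InnerProductSpace ℝ V] [CompleteSpace V]
    (F : V → V) {L m : ℝ} (hL : 0 < L) (hm : 0 < m)
    (hLip : ∀ x y, ‖F x - F y‖ ≤ L * ‖x - y‖)
    (hmono : ∀ x y, m * ‖x - y‖ ^ 2 ≤ ⟪F x - F y, x - y⟫) :
    Function.Bijective F := by
  constructor
  · intro x y hxy
    have h := hmono x y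
    rw [hxy, sub_self, inner_zero_left] at h
    have h0 : ‖x - y‖ ^ 2 ≤ 0 := by
      by_contra! hlt
      exact absurd h (not_le.mpr (mul_pos hm hlt))
    exact sub_eq_zero.mp (norm_eq_zero.mp (pow_eq_zero_iff two_ne_zero |>.mp
      (le_antisymm h0 (sq_nonneg _))))
  · intro f
    set t : ℝ := m / L ^ 2 with ht
    have htpos : 0 < t := by positivity
    set G : V → V := fun u => u - t • (F u - f) with hG
    have hcontr : ContractingWith (NNReal.sqrt (1 - m ^ 2 / L ^ 2).toNNReal) G := by
      refine ⟨?_, LipschitzWith.of_dist_le_mul fun x y => ?_⟩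
      · have : 0 < m ^ 2 / L ^ 2 := by positivity
        rw [← NNReal.coe_lt_coe, Real.coe_sqrt, NNReal.coe_one, Real.sqrt_lt' one_pos,
          Real.coe_toNNReal']
        exact max_lt (by linarith) (by norm_num)
      · have hdiff : G x - G y = (x - y) - t • (F x - F y) := by
          simp only [hG, smul_sub]
          abel
        rw [Real.coe_sqrt, dist_eq_norm, dist_eq_norm, hdiff]
        refine le_of_sq_le_sq ?_ (by positivity)
        rw [mul_pow, Real.sq_sqrt NNReal.zero_le_coe, Real.coe_toNNReal']
        have hsq : ‖F x - F y‖ ^ 2 ≤ L ^ 2 * ‖x - y‖ ^ 2 := by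
          rw [← mul_pow]
          gcongr
          exact hLip x y
        calc ‖x - y - t • (F x - F y)‖ ^ 2
            = ‖x - y‖ ^ 2 - 2 * t * ⟪F x - F y, x - y⟫ + t ^ 2 * ‖F x - F y‖ ^ 2 := by
              rw [norm_sub_sq_real, inner_smul_right, norm_smul, mul_pow, Real.norm_eq_abs,
                sq_abs, real_inner_comm]
              ring
          _ ≤ ‖x - y‖ ^ 2 - 2 * t * (m * ‖x - y‖ ^ 2) + t ^ 2 * (L ^ 2 * ‖x - y‖ ^ 2) := by
              gcongr
              exact hmono x y
          _ = (1 - m ^ 2 / L ^ 2) * ‖x - y‖ ^ 2 := by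
              rw [ht]
              field_simp
              ring
          _ ≤ max (1 - m ^ 2 / L ^ 2) 0 * ‖x - y‖ ^ 2 := by
              gcongr
              exact le_max_left _ _
    refine ⟨hcontr.fixedPoint, ?_⟩
    have hfix : G hcontr.fixedPoint = hcontr.fixedPoint := hcontr.fixedPoint_isFixedPt
    have hzero : t • (F hcontr.fixedPoint - f) = 0 := sub_eq_self.mp hfix
    exact sub_eq_zero.mp ((smul_eq_zero.mp hzero).resolve_left htpos.ne')

/-- If `P` is symmetric and positive and `⟪P (B ξ), B ξ⟫ ≤ q ⟪P (B ξ), ξ⟫` with `q ≤ 1` and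
`⟪P (B ξ), ξ⟫` nonnegative, then `⟪P (ξ - B ξ), ξ⟫` is nonnegative. -/
theorem inner_apply_sub_nonneg_of_contraction {T : Type*}
    [NormedAddCommGroup T] [InnerProductSpace ℝ T] (P : T →L[ℝ] T)
    (hsymm : ∀ x y, ⟪P x, y⟫ = ⟪x, P y⟫) (hpos : ∀ x, 0 ≤ ⟪P x, x⟫) {q : ℝ} (hq : q ≤ 1)
    {ξ η : T} (hη : ⟪P η, η⟫ ≤ q * ⟪P η, ξ⟫) (h0 : 0 ≤ ⟪P η, ξ⟫) :
    0 ≤ ⟪P (ξ - η), ξ⟫ := by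
  have h := hpos (ξ - η)
  have hc : ⟪P ξ, η⟫ = ⟪P η, ξ⟫ := by rw [hsymm, real_inner_comm]
  have hle : q * ⟪P η, ξ⟫ ≤ 1 * ⟪P η, ξ⟫ := by gcongr
  simp only [map_sub, inner_sub_left, inner_sub_right, hc] at h ⊢
  linarith

/-- The coupled problem splits into an equation for the first component, involving the Schur
complement, and an explicit formula for the second component. -/
theorem couplingForm_eq_iff {V W T : Type*}
    [NormedAddCommGroup V] [InnerProductSpace ℝ V] [CompleteSpace V]
    [NormedAddCommGroup W] [InnerProductSpace ℝ W] [CompleteSpace W]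
    [NormedAddCommGroup T] [InnerProductSpace ℝ T] [CompleteSpace T]
    (𝒰 : W → W) (c : V →L[ℝ] W) (γ : V →L[ℝ] T) (A C A' : T →L[ℝ] T)
    (hl : ∀ x, A (A' x) = x) (hr : ∀ x, A' (A x) = x) (f : V) (g : T) (u : V) (φ : T) :
    (∀ v ψ, couplingForm 𝒰 c γ A C u φ v ψ = ⟪f, v⟫ + ⟪g, ψ⟫) ↔
      c.adjoint (𝒰 (c u)) + γ.adjoint (A' ((1 / 2 : ℝ) • γ u + C (γ u))) =
          f + γ.adjoint (A' g) ∧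
        φ = A' (g - ((1 / 2 : ℝ) • γ u + C (γ u))) := by
  set η := (1 / 2 : ℝ) • γ u + C (γ u) with hη
  have hform : ∀ v ψ, couplingForm 𝒰 c γ A C u φ v ψ =
      ⟪c.adjoint (𝒰 (c u)) - γ.adjoint φ, v⟫ + ⟪A φ + η, ψ⟫ := by
    intro v ψ
    rw [couplingForm, ← hη, inner_sub_left, ContinuousLinearMap.adjoint_inner_left,
      ContinuousLinearMap.adjoint_inner_left, inner_add_left, real_inner_comm ψ (A φ),
      real_inner_comm ψ η]
    ring
  simp only [hform]
  constructor
  · intro h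
    have h1 : c.adjoint (𝒰 (c u)) - γ.adjoint φ = f :=
      ext_inner_right ℝ fun v => by simpa only [inner_zero_right, add_zero] using h v 0
    have h2 : A φ + η = g :=
      ext_inner_right ℝ fun ψ => by simpa only [inner_zero_right, zero_add] using h 0 ψ
    have hφ : φ = A' (g - η) := by rw [← h2, add_sub_cancel_right, hr]
    refine ⟨?_, hφ⟩
    rw [← h1, hφ, map_sub, map_sub]
    abel
  · rintro ⟨h1, hφ⟩ v ψ
    have h2 : A φ + η = g := by rw [hφ, hl, sub_add_cancel]
    have h3 : c.adjoint (𝒰 (c u)) - γ.adjoint φ = f := by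
      rw [hφ, map_sub, map_sub, eq_sub_of_add_eq h1]
      abel
    rw [h2, h3]

/-- abstract form of Theorem 4.3: well-posedness of the Johnson–Nédélec
coupling. Under the structural hypotheses, if `𝒰` is Lipschitz continuous with constant
`C_L^𝒰 > 0` and strongly monotone with constant `C_M^𝒰 > C_C/4`, then for every bounded
linear functional `ℓ : ℋ → ℝ` there exists a unique `𝐮 ∈ ℋ` with `b(𝐮, 𝐯) = ℓ(𝐯)` for
all `𝐯 ∈ ℋ`. -/
theorem couplingForm_wellPosed
    {V W T : Type*}
    [NormedAddCommGroup V] [InnerProductSpace ℝ V] [CompleteSpace V]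
    [NormedAddCommGroup W] [InnerProductSpace ℝ W] [CompleteSpace W]
    [NormedAddCommGroup T] [InnerProductSpace ℝ T] [CompleteSpace T]
    (𝒰 : W → W) (c : V →L[ℝ] W) (γ : V →L[ℝ] T) (A C A' : T →L[ℝ] T)
    (CA : ℝ) (hCA : 0 < CA)
    (hAsym : ∀ x y : T, ⟪A x, y⟫ = ⟪x, A y⟫)
    (hAcoer : ∀ ξ : T, CA * ‖ξ‖ ^ 2 ≤ ⟪A ξ, ξ⟫)
    (hA'l : A.comp A' = ContinuousLinearMap.id ℝ T)
    (hA'r : A'.comp A = ContinuousLinearMap.id ℝ T)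
    (α : ℝ) (hα : 0 < α) (hFriedrichs : ∀ v : V, α * ‖v‖ ≤ ‖c v‖)
    (hsplit : ∀ w : V, ∃ wΓ wt : V, w = wΓ + wt ∧ γ wt = 0 ∧ ⟪c wΓ, c wt⟫ = 0 ∧
      ‖c wΓ‖ ^ 2 = ⟪(A'.comp ((1 / 2 : ℝ) • ContinuousLinearMap.id ℝ T - C)) (γ w), γ w⟫)
    (CC : ℝ) (hCC : CC ∈ Set.Ico (1 / 2 : ℝ) 1)
    (hcontr : ∀ ξ : T, ⟪A' ((1 / 2 : ℝ) • ξ - C ξ), (1 / 2 : ℝ) • ξ - C ξ⟫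
      ≤ CC * ⟪(A'.comp ((1 / 2 : ℝ) • ContinuousLinearMap.id ℝ T - C)) ξ, ξ⟫)
    (CLU : ℝ) (hCLU : 0 < CLU)
    (hLipU : ∀ x y : W, ‖𝒰 x - 𝒰 y‖ ≤ CLU * ‖x - y‖)
    (CMU : ℝ) (hCMU : 0 < CMU)
    (hmonoU : ∀ x y : W, CMU * ‖x - y‖ ^ 2 ≤ ⟪𝒰 x - 𝒰 y, x - y⟫)
    (hcond : CC / 4 < CMU)
    (ℓ : (V × T) →L[ℝ] ℝ) :
    ∃! uφ : V × T, ∀ (v : V) (ψ : T),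
      couplingForm 𝒰 c γ A C uφ.1 uφ.2 v ψ = ℓ (v, ψ) := by
  have hl : ∀ x, A (A' x) = x := fun x => DFunLike.congr_fun hA'l x
  have hr : ∀ x, A' (A x) = x := fun x => DFunLike.congr_fun hA'r x
  have hsymm : ∀ x y, ⟪A' x, y⟫ = ⟪x, A' y⟫ := fun x y => by
    rw [← hl y, ← hAsym, hl, hl]
  have hpos : ∀ x, 0 ≤ ⟪A' x, x⟫ := fun x => by
    have h := hAcoer (A' x)
    rw [hl, real_inner_comm] at h
    exact le_trans (by positivity) h
  set R : T →L[ℝ] T := (1 / 2 : ℝ) • ContinuousLinearMap.id ℝ T + C with hR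
  have hRapp : ∀ ξ, R ξ = (1 / 2 : ℝ) • ξ + C ξ := fun ξ => rfl
  set M : V →L[ℝ] V := γ.adjoint ∘L A' ∘L R ∘L γ with hM
  have hMpos : ∀ w, 0 ≤ ⟪M w, w⟫ := by
    intro w
    obtain ⟨wΓ, wt, -, -, -, hS⟩ := hsplit w
    have hS' : ‖c wΓ‖ ^ 2 = ⟪A' ((1 / 2 : ℝ) • γ w - C (γ w)), γ w⟫ := hS
    have h := inner_apply_sub_nonneg_of_contraction A' hsymm hpos hCC.2.le
      (hcontr (γ w)) (hS' ▸ sq_nonneg _)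
    have hsub : γ w - ((1 / 2 : ℝ) • γ w - C (γ w)) = R (γ w) := by
      rw [hRapp]
      module
    rw [hsub] at h
    simpa [hM, ContinuousLinearMap.adjoint_inner_left] using h
  set F : V → V := fun u => c.adjoint (𝒰 (c u)) + M u with hF
  have hFsub : ∀ x y, F x - F y = c.adjoint (𝒰 (c x) - 𝒰 (c y)) + M (x - y) := by
    intro x y
    simp only [hF, map_sub]
    abel
  have hbij : Function.Bijective F := by
    refine bijective_of_lipschitz_of_stronglyMonotone F
      (L := ‖c.adjoint‖ * (CLU * ‖c‖) + ‖M‖ + 1) (m := CMU * α ^ 2) (by positivity)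
      (by positivity) (fun x y => ?_) fun x y => ?_
    · rw [hFsub]
      have hc : ‖𝒰 (c x) - 𝒰 (c y)‖ ≤ CLU * (‖c‖ * ‖x - y‖) := by
        refine (hLipU _ _).trans ?_
        rw [← map_sub]
        gcongr
        exact c.le_opNorm _
      calc ‖c.adjoint (𝒰 (c x) - 𝒰 (c y)) + M (x - y)‖
          ≤ ‖c.adjoint (𝒰 (c x) - 𝒰 (c y))‖ + ‖M (x - y)‖ := norm_add_le _ _
        _ ≤ ‖c.adjoint‖ * (CLU * (‖c‖ * ‖x - y‖)) + ‖M‖ * ‖x - y‖ :=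
            add_le_add (c.adjoint.le_opNorm_of_le hc) (M.le_opNorm _)
        _ ≤ (‖c.adjoint‖ * (CLU * ‖c‖) + ‖M‖ + 1) * ‖x - y‖ := by
            linarith [norm_nonneg (x - y)]
    · rw [hFsub, inner_add_left, ContinuousLinearMap.adjoint_inner_left, map_sub c]
      have hsq : (α * ‖x - y‖) ^ 2 ≤ ‖c x - c y‖ ^ 2 := by
        rw [← map_sub]
        gcongr
        exact hFriedrichs _
      calc CMU * α ^ 2 * ‖x - y‖ ^ 2 = CMU * (α * ‖x - y‖) ^ 2 := by ring
        _ ≤ CMU * ‖c x - c y‖ ^ 2 := by gcongr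
        _ ≤ ⟪𝒰 (c x) - 𝒰 (c y), c x - c y⟫ := hmonoU _ _
        _ ≤ _ := le_add_of_nonneg_right (hMpos _)
  set f : V := (InnerProductSpace.toDual ℝ V).symm (ℓ ∘L ContinuousLinearMap.inl ℝ V T) with hf
  set g : T := (InnerProductSpace.toDual ℝ T).symm (ℓ ∘L ContinuousLinearMap.inr ℝ V T) with hg
  have hℓ : ∀ v ψ, ℓ (v, ψ) = ⟪f, v⟫ + ⟪g, ψ⟫ := by
    intro v ψ
    rw [hf, hg, InnerProductSpace.toDual_symm_apply, InnerProductSpace.toDual_symm_apply]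
    simp [← map_add]
  have hiff := couplingForm_eq_iff 𝒰 c γ A C A' hl hr f g
  simp only [hℓ, hiff]
  obtain ⟨u, hu, huniq⟩ := hbij.existsUnique (f + γ.adjoint (A' g))
  refine ⟨(u, A' (g - R (γ u))), ⟨hu, rfl⟩, ?_⟩
  rintro ⟨u', φ'⟩ ⟨h1, h2⟩
  obtain rfl : u' = u := huniq u' h1
  exact Prod.ext rfl h2
end

section
/- Let H be a real Hilbert space, B : H → H Lipschitz continuous with constant C_L > 0 and strongly monotone with constant C_M > 0, V ⊆ H a closed linear subspace, and ℓ : H → ℝ a bounded linear functional. Let u ∈ H satisfy ⟨Bu, v⟩ = ℓ(v) for all v ∈ H, and let u_V ∈ V satisfy ⟨B u_V, v⟩ = ℓ(v) for all v ∈ V. Let F : H → ℝ be a bounded linear functional and let w ∈ H solve the dual problem ⟨B v, w⟩ = F(v) for all v ∈ H. Then for all v_V ∈ V and z_V ∈ V: |F(u) − F(u_V)| ≤ (C_L²/C_M)·‖u − v_V‖·‖w − z_V‖. -/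
open scoped RealInnerProductSpace

/-- Céa quasi-optimality: if the residual `B u - B u'` is orthogonal to `V`, then `u' ∈ V` is a
quasi-best approximation of `u` in `V`. -/
theorem mul_norm_sub_le_of_strongly_monotone_of_orthogonal
    {H : Type*} [NormedAddCommGroup H] [InnerProductSpace ℝ H]
    {B : H → H} {CL CM : ℝ}
    (hLip : ∀ u v : H, ‖B u - B v‖ ≤ CL * ‖u - v‖)
    (hMono : ∀ u v : H, CM * ‖u - v‖ ^ 2 ≤ ⟪B u - B v, u - v⟫)
    {V : Submodule ℝ H} {u u' : H} (hu' : u' ∈ V)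
    (horth : ∀ v ∈ V, ⟪B u - B u', v⟫ = 0) {v : H} (hv : v ∈ V) :
    CM * ‖u - u'‖ ≤ CL * ‖u - v‖ := by
  have hshift : ⟪B u - B u', u - u'⟫ = ⟪B u - B u', u - v⟫ := by
    rw [← sub_eq_zero, ← inner_sub_right, sub_sub_sub_cancel_left]
    exact horth _ (V.sub_mem hv hu')
  have hsq : CM * ‖u - u'‖ ^ 2 ≤ CL * ‖u - u'‖ * ‖u - v‖ := calc
    CM * ‖u - u'‖ ^ 2 ≤ ⟪B u - B u', u - v⟫ := hshift ▸ hMono u u'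
    _ ≤ ‖B u - B u'‖ * ‖u - v‖ := real_inner_le_norm _ _
    _ ≤ CL * ‖u - u'‖ * ‖u - v‖ := by gcongr; exact hLip u u'
  rcases (norm_nonneg (u - u')).eq_or_lt with h | h
  · have hB : 0 ≤ CL * ‖u - v‖ := (norm_nonneg _).trans (hLip u v)
    rwa [← h, mul_zero]
  · exact le_of_mul_le_mul_right (by linarith) h

/-- Aubin–Nitsche-type estimate, Theorem 5.3, inequality (5.2). Let `H`
be a real Hilbert space, `B : H → H` Lipschitz continuous with constant `C_L > 0` and
strongly monotone with constant `C_M > 0`, `V ⊆ H` a closed linear subspace, `ℓ` a bounded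
linear functional, `u` the continuous solution, `u_V ∈ V` the Galerkin solution, `F` a
bounded linear functional and `w` a solution of the dual problem `⟪Bv, w⟫ = F(v)` for all
`v`. Then `|F(u) − F(u_V)| ≤ (C_L²/C_M)·‖u − v_V‖·‖w − z_V‖` for all `v_V, z_V ∈ V`. -/
theorem aubin_nitsche
    {H : Type*} [NormedAddCommGroup H] [InnerProductSpace ℝ H] [CompleteSpace H]
    (B : H → H) (CL CM : ℝ) (hCL : 0 < CL) (hCM : 0 < CM)
    (hLip : ∀ u v : H, ‖B u - B v‖ ≤ CL * ‖u - v‖)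
    (hMono : ∀ u v : H, CM * ‖u - v‖ ^ 2 ≤ ⟪B u - B v, u - v⟫)
    (V : Submodule ℝ H) (hV : IsClosed (V : Set H)) (ℓ : H →L[ℝ] ℝ)
    (u : H) (hu : ∀ v : H, ⟪B u, v⟫ = ℓ v)
    (uV : H) (huV : uV ∈ V) (huVsol : ∀ v ∈ V, ⟪B uV, v⟫ = ℓ v)
    (F : H →L[ℝ] ℝ) (w : H) (hw : ∀ v : H, ⟪B v, w⟫ = F v) :
    ∀ vV ∈ V, ∀ zV ∈ V,
      |F u - F uV| ≤ (CL ^ 2 / CM) * ‖u - vV‖ * ‖w - zV‖ := by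
  intro vV hvV zV hzV
  have horth : ∀ v ∈ V, ⟪B u - B uV, v⟫ = 0 := fun v hv => by
    rw [inner_sub_left, hu, huVsol v hv, sub_self]
  have hcea : ‖u - uV‖ ≤ CL * ‖u - vV‖ / CM := by
    rw [le_div_iff₀' hCM]
    exact mul_norm_sub_le_of_strongly_monotone_of_orthogonal hLip hMono huV horth hvV
  have hF : F u - F uV = ⟪B u - B uV, w - zV⟫ := by
    rw [inner_sub_right, horth zV hzV, sub_zero, inner_sub_left, hw, hw]
  calc |F u - F uV| ≤ ‖B u - B uV‖ * ‖w - zV‖ := hF ▸ abs_real_inner_le_norm _ _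
    _ ≤ CL * (CL * ‖u - vV‖ / CM) * ‖w - zV‖ := by
      gcongr
      exact (hLip u uV).trans (by gcongr)
    _ = (CL ^ 2 / CM) * ‖u - vV‖ * ‖w - zV‖ := by ring
end
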